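/- Under the stated hypotheses on ψ₁ and Γ (including Γ(r,±a) = 0), there is an absolute constant c such that ∫_Ω ( (∂_r∂_z²ψ₁)² + (∂_z³ψ₁)² ) + ∫_{−a}^{a} (∂_z²ψ₁(0,z))² dz ≤ c |∂_zΓ|²_{2,Ω}. -/

import Mathlib

open MeasureTheory Real Set ENNReal

noncomputable section

/-- Partial derivative in `r` of a function `w r z` of two variables. -/
def qdr (w : ℝ → ℝ → ℝ) : ℝ → ℝ → ℝ := fun r z => deriv (fun x => w x z) r

/-- Partial derivative in `z` of a function `w r z` of two variables. -/
def qdz (w : ℝ → ℝ → ℝ) : ℝ → ℝ → ℝ := fun r z => deriv (fun x => w r x) z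

/-- The integral `∫_Ω w` over the rectangle `(0,R) × (-a,a)` with respect to the
measure `r dr dz`. -/
def I2 (R a : ℝ) (w : ℝ → ℝ → ℝ) : ℝ :=
  ∫ q in (Ioo (0 : ℝ) R) ×ˢ (Ioo (-a) a), w q.1 q.2 * q.1

/-- The data of the elliptic problem for the modified stream function: smooth functions
`ψ₁` and `Γ` on the rectangle `[0,R] × [-a,a]` satisfying
`−∂_r²ψ₁ − (3/r)∂_rψ₁ − ∂_z²ψ₁ = Γ` in the interior (i.e. `−Δψ₁ − (2/r)∂_rψ₁ = Γ`),
the boundary conditions `ψ₁(R,·) = 0`, `ψ₁(·,±a) = 0`, and the axis condition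
`∂_rψ₁(0,·) = 0`. -/
structure StreamData (R a : ℝ) where
  psi : ℝ → ℝ → ℝ
  Gam : ℝ → ℝ → ℝ
  smooth_psi : ContDiff ℝ (⊤ : ℕ∞) (fun q : ℝ × ℝ => psi q.1 q.2)
  smooth_Gam : ContDiff ℝ (⊤ : ℕ∞) (fun q : ℝ × ℝ => Gam q.1 q.2)
  eqn : ∀ r ∈ Ioo (0 : ℝ) R, ∀ z ∈ Ioo (-a) a,
    -qdr (qdr psi) r z - (3 / r) * qdr psi r z - qdz (qdz psi) r z = Gam r z
  bc_lat : ∀ z ∈ Icc (-a) a, psi R z = 0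
  bc_horiz : ∀ r ∈ Icc (0 : ℝ) R, psi r a = 0 ∧ psi r (-a) = 0
  axis : ∀ z ∈ Icc (-a) a, qdr psi 0 z = 0

/-- Joint smoothness of a function of two variables. -/
def Sm (w : ℝ → ℝ → ℝ) : Prop := ContDiff ℝ (⊤ : ℕ∞) (fun q : ℝ × ℝ => w q.1 q.2)

lemma Sm.hasR {w : ℝ → ℝ → ℝ} (h : Sm w) (r z : ℝ) :
    HasDerivAt (fun x => w x z) (fderiv ℝ (fun q : ℝ × ℝ => w q.1 q.2) (r, z) (1, 0)) r := by
  have h1 : HasFDerivAt (fun q : ℝ × ℝ => w q.1 q.2) _ (r, z) :=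
    (ContDiff.differentiable h (by simp) (r, z)).hasFDerivAt
  have h2 : HasDerivAt (fun x : ℝ => ((x, z) : ℝ × ℝ)) (1, 0) r :=
    (hasDerivAt_id r).prodMk (hasDerivAt_const r z)
  exact h1.comp_hasDerivAt r h2

lemma Sm.hasZ {w : ℝ → ℝ → ℝ} (h : Sm w) (r z : ℝ) :
    HasDerivAt (fun x => w r x) (fderiv ℝ (fun q : ℝ × ℝ => w q.1 q.2) (r, z) (0, 1)) z := by
  have h1 : HasFDerivAt (fun q : ℝ × ℝ => w q.1 q.2) _ (r, z) :=
    (ContDiff.differentiable h (by simp) (r, z)).hasFDerivAt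
  have h2 : HasDerivAt (fun x : ℝ => ((r, x) : ℝ × ℝ)) (0, 1) z :=
    (hasDerivAt_const z r).prodMk (hasDerivAt_id z)
  exact h1.comp_hasDerivAt z h2

lemma Sm.qdr_eq {w : ℝ → ℝ → ℝ} (h : Sm w) (r z : ℝ) :
    qdr w r z = fderiv ℝ (fun q : ℝ × ℝ => w q.1 q.2) (r, z) (1, 0) := (h.hasR r z).deriv

lemma Sm.qdz_eq {w : ℝ → ℝ → ℝ} (h : Sm w) (r z : ℝ) :
    qdz w r z = fderiv ℝ (fun q : ℝ × ℝ => w q.1 q.2) (r, z) (0, 1) := (h.hasZ r z).deriv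

lemma Sm.dR {w : ℝ → ℝ → ℝ} (h : Sm w) (r z : ℝ) :
    HasDerivAt (fun x => w x z) (qdr w r z) r := by
  rw [h.qdr_eq]; exact h.hasR r z

lemma Sm.dZ {w : ℝ → ℝ → ℝ} (h : Sm w) (r z : ℝ) :
    HasDerivAt (fun x => w r x) (qdz w r z) z := by
  rw [h.qdz_eq]; exact h.hasZ r z

lemma Sm.fd {w : ℝ → ℝ → ℝ} (h : Sm w) :
    ContDiff ℝ (⊤ : ℕ∞) (fderiv ℝ (fun q : ℝ × ℝ => w q.1 q.2)) :=
  ContDiff.fderiv_right h (by simp)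

lemma Sm.r {w : ℝ → ℝ → ℝ} (h : Sm w) : Sm (qdr w) := by
  have : (fun q : ℝ × ℝ => qdr w q.1 q.2)
      = fun q => fderiv ℝ (fun q : ℝ × ℝ => w q.1 q.2) q (1, 0) := by
    funext q; exact h.qdr_eq q.1 q.2
  unfold Sm
  rw [this]
  exact h.fd.clm_apply contDiff_const

lemma Sm.z {w : ℝ → ℝ → ℝ} (h : Sm w) : Sm (qdz w) := by
  have : (fun q : ℝ × ℝ => qdz w q.1 q.2)
      = fun q => fderiv ℝ (fun q : ℝ × ℝ => w q.1 q.2) q (0, 1) := by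
    funext q; exact h.qdz_eq q.1 q.2
  unfold Sm
  rw [this]
  exact h.fd.clm_apply contDiff_const

lemma Sm.cont {w : ℝ → ℝ → ℝ} (h : Sm w) : Continuous (fun q : ℝ × ℝ => w q.1 q.2) :=
  ContDiff.continuous h

lemma Sm.comm {w : ℝ → ℝ → ℝ} (h : Sm w) : qdz (qdr w) = qdr (qdz w) := by
  funext r z
  have e1 : (fun q : ℝ × ℝ => qdr w q.1 q.2)
      = fun q => fderiv ℝ (fun q : ℝ × ℝ => w q.1 q.2) q (1, 0) := by
    funext q; exact h.qdr_eq q.1 q.2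
  have e2 : (fun q : ℝ × ℝ => qdz w q.1 q.2)
      = fun q => fderiv ℝ (fun q : ℝ × ℝ => w q.1 q.2) q (0, 1) := by
    funext q; exact h.qdz_eq q.1 q.2
  have hd : DifferentiableAt ℝ (fderiv ℝ (fun q : ℝ × ℝ => w q.1 q.2)) (r, z) :=
    h.fd.differentiable (by simp) (r, z)
  rw [h.r.qdz_eq, h.z.qdr_eq, e1, e2,
    fderiv_clm_apply hd (by fun_prop), fderiv_clm_apply hd (by fun_prop)]
  have hs : IsSymmSndFDerivAt ℝ (fun q : ℝ × ℝ => w q.1 q.2) (r, z) :=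
    (ContDiff.contDiffAt h).isSymmSndFDerivAt (by
      rw [minSmoothness_of_isRCLikeNormedField]; exact WithTop.coe_le_coe.mpr (le_top : (2 : ℕ∞) ≤ ⊤))
  have := hs.eq (0, 1) (1, 0)
  simpa using this

/-- Integral over the rectangle. -/
def KK (R a : ℝ) (f : ℝ × ℝ → ℝ) : ℝ := ∫ q in (Ioo (0 : ℝ) R) ×ˢ (Ioo (-a) a), f q

lemma KK_int (R a : ℝ) {f : ℝ × ℝ → ℝ} (hf : Continuous f) :
    IntegrableOn f ((Ioo (0 : ℝ) R) ×ˢ (Ioo (-a) a)) :=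
  (hf.continuousOn.integrableOn_compact (isCompact_Icc.prod isCompact_Icc)).mono_set
    (prod_mono Ioo_subset_Icc_self Ioo_subset_Icc_self)

lemma KK_comb (R a : ℝ) {f g h : ℝ × ℝ → ℝ} (hf : Continuous f) (hg : Continuous g)
    (hh : Continuous h) :
    (∫ q in (Ioo (0 : ℝ) R) ×ˢ (Ioo (-a) a), (2 * (f q + g q) + h q)) =
      2 * ((∫ q in (Ioo (0 : ℝ) R) ×ˢ (Ioo (-a) a), f q)
        + ∫ q in (Ioo (0 : ℝ) R) ×ˢ (Ioo (-a) a), g q)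
      + ∫ q in (Ioo (0 : ℝ) R) ×ˢ (Ioo (-a) a), h q := by
  have h1 : Continuous fun q => 2 * (f q + g q) := by fun_prop
  rw [integral_add (KK_int R a h1) (KK_int R a hh),
    integral_const_mul, integral_add (KK_int R a hf) (KK_int R a hg)]

lemma KK_rz {R a : ℝ} (ha : 0 < a) {f : ℝ × ℝ → ℝ} (hf : Continuous f) :
    KK R a f = ∫ r in Ioo (0 : ℝ) R, ∫ z in (-a)..a, f (r, z) := by
  unfold KK
  have hi := KK_int R a hf
  rw [Measure.volume_eq_prod] at hi ⊢
  rw [setIntegral_prod _ hi]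
  simp_rw [intervalIntegral.integral_of_le (by linarith : -a ≤ a), integral_Ioc_eq_integral_Ioo]

lemma KK_zr {R a : ℝ} (hR : 0 < R) {f : ℝ × ℝ → ℝ} (hf : Continuous f) :
    KK R a f = ∫ z in Ioo (-a) a, ∫ r in (0 : ℝ)..R, f (r, z) := by
  unfold KK
  have hi := KK_int R a hf
  rw [Measure.volume_eq_prod] at hi ⊢
  rw [← Measure.prod_restrict, integral_prod_symm _ (by rw [Measure.prod_restrict]; exact hi)]
  simp_rw [intervalIntegral.integral_of_le hR.le, integral_Ioc_eq_integral_Ioo]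

lemma horiz_zero {R a : ℝ} (ha : 0 < a) (S : StreamData R a) (b : ℝ) (hb : b ∈ Icc (-a) a)
    (h0 : ∀ r ∈ Icc (0 : ℝ) R, S.psi r b = 0) (hG : ∀ r ∈ Icc (0 : ℝ) R, S.Gam r b = 0) :
    ∀ r ∈ Ioo (0 : ℝ) R, qdz (qdz S.psi) r b = 0 := by
  intro r hr
  have hp : Sm S.psi := S.smooth_psi
  have hg : Sm S.Gam := S.smooth_Gam
  have d1 : ∀ x ∈ Ioo (0 : ℝ) R, qdr S.psi x b = 0 := by
    intro x hx
    have : (fun y => S.psi y b) =ᶠ[nhds x] fun _ => 0 := by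
      filter_upwards [isOpen_Ioo.mem_nhds hx] with y hy
      exact h0 y (Ioo_subset_Icc_self hy)
    unfold qdr
    rw [this.deriv_eq]; simp
  have d2 : qdr (qdr S.psi) r b = 0 := by
    have : (fun y => qdr S.psi y b) =ᶠ[nhds r] fun _ => 0 := by
      filter_upwards [isOpen_Ioo.mem_nhds hr] with y hy
      exact d1 y hy
    rw [qdr, this.deriv_eq]; simp
  have hc : Continuous fun z => -qdr (qdr S.psi) r z - (3 / r) * qdr S.psi r z
      - qdz (qdz S.psi) r z - S.Gam r z := by
    have c1 := hp.r.r.cont.comp (Continuous.prodMk_right r)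
    have c2 := hp.r.cont.comp (Continuous.prodMk_right r)
    have c3 := hp.z.z.cont.comp (Continuous.prodMk_right r)
    have c4 := hg.cont.comp (Continuous.prodMk_right r)
    exact ((c1.neg.sub (c2.const_smul (3 / r))).sub c3).sub c4
  have hcl : IsClosed {z | -qdr (qdr S.psi) r z - (3 / r) * qdr S.psi r z
      - qdz (qdz S.psi) r z - S.Gam r z = 0} := isClosed_eq hc continuous_const
  have hsub := closure_minimal (s := Ioo (-a) a) (fun z hz => by simp only [mem_ofPred_eq]; rw [S.eqn r hr z hz]; ring) hcl
  rw [closure_Ioo (by linarith)] at hsub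
  have := hsub hb
  simp only [mem_ofPred_eq] at this
  rw [d2, d1 r hr, hG r (Ioo_subset_Icc_self hr)] at this
  linarith

lemma lat_zero {R a : ℝ} (S : StreamData R a) :
    ∀ z ∈ Ioo (-a) a, qdz (qdz S.psi) R z = 0 := by
  have d1 : ∀ x ∈ Ioo (-a) a, qdz S.psi R x = 0 := by
    intro x hx
    have : (fun y => S.psi R y) =ᶠ[nhds x] fun _ => 0 := by
      filter_upwards [isOpen_Ioo.mem_nhds hx] with y hy
      exact S.bc_lat y (Ioo_subset_Icc_self hy)
    unfold qdz
    rw [this.deriv_eq]; simp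
  intro z hz
  have : (fun y => qdz S.psi R y) =ᶠ[nhds z] fun _ => 0 := by
    filter_upwards [isOpen_Ioo.mem_nhds hz] with y hy
    exact d1 y hy
  rw [qdz, this.deriv_eq]; simp

/-- The equation differentiated twice in `z`. -/
lemma eqn_zz {R a : ℝ} (S : StreamData R a) :
    ∀ r ∈ Ioo (0 : ℝ) R, ∀ z ∈ Ioo (-a) a,
      r * qdr (qdr (qdz (qdz S.psi))) r z + 3 * qdr (qdz (qdz S.psi)) r z
        + r * qdz (qdz (qdz (qdz S.psi))) r z + r * qdz (qdz S.Gam) r z = 0 := by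
  intro r hr
  have hp : Sm S.psi := S.smooth_psi
  have hg : Sm S.Gam := S.smooth_Gam
  have key : ∀ A B C D : ℝ → ℝ → ℝ, Sm A → Sm B → Sm C → Sm D →
      (∀ z ∈ Ioo (-a) a, r * A r z + 3 * B r z + r * C r z + r * D r z = 0) →
      ∀ z ∈ Ioo (-a) a, r * qdz A r z + 3 * qdz B r z + r * qdz C r z + r * qdz D r z = 0 := by
    intro A B C D hA hB hC hD h z hz
    have h1 := ((((hA.dZ r z).const_mul r).add ((hB.dZ r z).const_mul 3)).add
      ((hC.dZ r z).const_mul r)).add ((hD.dZ r z).const_mul r)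
    refine h1.unique ((hasDerivAt_const z (0 : ℝ)).congr_of_eventuallyEq ?_)
    filter_upwards [isOpen_Ioo.mem_nhds hz] with y hy
    exact h y hy
  have e0 : ∀ z ∈ Ioo (-a) a, r * qdr (qdr S.psi) r z + 3 * qdr S.psi r z
      + r * qdz (qdz S.psi) r z + r * S.Gam r z = 0 := by
    intro z hz
    have h := S.eqn r hr z hz
    have hr0 : r ≠ 0 := hr.1.ne'
    rw [← h]; field_simp; ring
  have e2 := key _ _ _ _ hp.r.r.z hp.r.z hp.z.z.z hg.z
    (key _ _ _ _ hp.r.r hp.r hp.z.z hg e0)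
  rw [hp.r.comm, hp.comm, hp.z.r.comm, hp.z.comm] at e2
  exact e2

/-- first `H³` elliptic estimate for `ψ₁`: if moreover `Γ(·,±a) = 0`,
then `∫_Ω ((∂_r∂_z²ψ₁)² + (∂_z³ψ₁)²) + ∫_{−a}^{a} (∂_z²ψ₁(0,z))² dz ≤ c |∂_zΓ|²_{2,Ω}`
for an absolute constant `c`. -/
theorem statement10 :
    ∃ c : ℝ,
      ∀ (R a : ℝ), 0 < R → 0 < a → ∀ S : StreamData R a,
        (∀ r ∈ Set.Icc (0 : ℝ) R, S.Gam r a = 0 ∧ S.Gam r (-a) = 0) →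
        I2 R a (fun r z =>
            (qdr (qdz (qdz S.psi)) r z) ^ 2 + (qdz (qdz (qdz S.psi)) r z) ^ 2) +
          (∫ z in Set.Ioo (-a) a, (qdz (qdz S.psi) 0 z) ^ 2) ≤
        c * I2 R a (fun r z => (qdz S.Gam r z) ^ 2) := by
  refine ⟨1, ?_⟩
  intro R a hR ha S hGam
  have hp : Sm S.psi := S.smooth_psi
  have hg : Sm S.Gam := S.smooth_Gam
  have hw : Sm (qdz (qdz S.psi)) := hp.z.z
  have hE := eqn_zz S
  have hL := lat_zero S
  have hT := horiz_zero ha S a ⟨by linarith, le_rfl⟩ (fun r hr => (S.bc_horiz r hr).1)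
    (fun r hr => (hGam r hr).1)
  have hB := horiz_zero ha S (-a) ⟨le_rfl, by linarith⟩ (fun r hr => (S.bc_horiz r hr).2)
    (fun r hr => (hGam r hr).2)
  generalize hww : qdz (qdz S.psi) = w at *
  have c0 := hw.cont
  have c1 := hw.r.cont
  have c2 := hw.r.r.cont
  have c3 := hw.z.cont
  have c4 := hw.z.z.cont
  have c5 := hg.z.cont
  have c6 := hg.z.z.cont
  -- radial identity
  have hF1 : Continuous (fun q : ℝ × ℝ => (q.1 * qdr (qdr w) q.1 q.2 + 3 * qdr w q.1 q.2)
      * w q.1 q.2 + q.1 * qdr w q.1 q.2 ^ 2) := by fun_prop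
  have K1 := KK_zr (a := a) hR hF1
  have K1' : ∀ z ∈ Ioo (-a) a, (∫ r in (0 : ℝ)..R, ((r * qdr (qdr w) r z + 3 * qdr w r z)
      * w r z + r * qdr w r z ^ 2)) = - (w 0 z) ^ 2 := by
    intro z hz
    rw [intervalIntegral.integral_eq_sub_of_hasDerivAt
      (f := fun r => r * w r z * qdr w r z + w r z ^ 2)]
    · rw [hL z hz]; ring
    · intro r _
      have h1 := (((hasDerivAt_id r).mul (hw.dR r z)).mul (hw.r.dR r z)).add ((hw.dR r z).pow 2)
      refine h1.congr_deriv ?_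
      simp
      ring
    · exact (hF1.comp (Continuous.prodMk_left z)).intervalIntegrable _ _
  rw [setIntegral_congr_fun measurableSet_Ioo K1', integral_neg] at K1
  -- axial identity
  have hF2 : Continuous (fun q : ℝ × ℝ => q.1 * (qdz (qdz w) q.1 q.2 * w q.1 q.2
      + qdz w q.1 q.2 ^ 2 + qdz (qdz S.Gam) q.1 q.2 * w q.1 q.2
      + qdz S.Gam q.1 q.2 * qdz w q.1 q.2)) := by fun_prop
  have K2 := KK_rz (R := R) ha hF2
  have K2' : ∀ r ∈ Ioo (0 : ℝ) R, (∫ z in (-a)..a, (r * (qdz (qdz w) r z * w r z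
      + qdz w r z ^ 2 + qdz (qdz S.Gam) r z * w r z + qdz S.Gam r z * qdz w r z))) = 0 := by
    intro r hr
    rw [intervalIntegral.integral_eq_sub_of_hasDerivAt
      (f := fun z => r * ((qdz w r z + qdz S.Gam r z) * w r z))]
    · rw [hT r hr, hB r hr]; ring
    · intro z _
      have h1 := ((((hw.z.dZ r z).add (hg.z.dZ r z)).mul (hw.dZ r z))).const_mul r
      refine h1.congr_deriv ?_
      simp only [Pi.add_apply]
      ring
    · exact (hF2.comp (Continuous.prodMk_right r)).intervalIntegrable _ _
  rw [setIntegral_congr_fun measurableSet_Ioo K2', integral_zero] at K2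
  have hF3 : Continuous (fun q : ℝ × ℝ => (qdr w q.1 q.2 ^ 2 + qdz w q.1 q.2 ^ 2) * q.1) := by
    fun_prop
  have hF4 : Continuous (fun q : ℝ × ℝ => qdz S.Gam q.1 q.2 ^ 2 * q.1) := by fun_prop
  have main := setIntegral_mono_on (KK_int R a hF3)
    ((((KK_int R a hF1).add (KK_int R a hF2)).const_mul 2).add (KK_int R a hF4))
    (measurableSet_Ioo.prod measurableSet_Ioo) (by
      rintro ⟨r, z⟩ ⟨hr, hz⟩
      simp only [Pi.add_apply] at *
      have e := hE r hr z hz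
      have p1 : 0 ≤ r * (qdr w r z) ^ 2 := mul_nonneg hr.1.le (sq_nonneg _)
      have p2 : 0 ≤ r * (qdz w r z + qdz S.Gam r z) ^ 2 := mul_nonneg hr.1.le (sq_nonneg _)
      linear_combination p1 + p2 - 2 * w r z * e)
  replace main := main.trans (KK_comb R a hF1 hF2 hF4).le
  unfold KK at K1 K2
  rw [K1, K2] at main
  have hpos : 0 ≤ ∫ z in Ioo (-a) a, w 0 z ^ 2 := integral_nonneg fun z => sq_nonneg _
  unfold I2
  linarith
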